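/- arXiv:2111.11556 — 2 statements merged into one kernel-verified Lean document; each statement's English description precedes it below -/
import Mathlib

section
/- Let f₁,…,fₙ : ℝ^d → ℝ be differentiable with each f_i L_i-smooth and μ_i-strongly convex (μ_i > 0), let α₁,…,αₙ ∈ (0,1], let x_i be the minimizer of f_i, and define f̃(x) = (1/n)∑_{i=1}^n f_i(α_i x + (1−α_i)x_i), L_α = (1/n)∑_{i=1}^n α_i² L_i, μ_α = (1/n)∑_{i=1}^n α_i² μ_i, L̂ = (1/n)∑_{i=1}^n L_i, w_i = α_i² L_i/(n L_α), x^avg = ∑_{i=1}^n w_i x_i, D = max_{i≠j} ‖x_i − x_j‖², and α_max = max_i α_i. Let x^0 = x^avg and x^{k+1} = x^k − (1/L_α)·(1/n)∑_{i=1}^n α_i ∇f_i(α_i x^k + (1−α_i)x_i). Then for every K ≥ 0, f̃(x^K) − min_{x∈ℝ^d} f̃(x) ≤ (1 − μ_α/L_α)^K · α_max² L̂ D / 2. -/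
open scoped RealInnerProductSpace

/-- `g` is `L`-smooth: its gradient is `L`-Lipschitz. -/
def LSmooth {d : ℕ} (L : ℝ) (g : EuclideanSpace ℝ (Fin d) → ℝ) : Prop :=
  ∀ x y, ‖gradient g x - gradient g y‖ ≤ L * ‖x - y‖

/-- `g` is `μ`-strongly convex. -/
def StrongConvexWith {d : ℕ} (μ : ℝ) (g : EuclideanSpace ℝ (Fin d) → ℝ) : Prop :=
  ∀ x y, g y + ⟪gradient g y, x - y⟫ + μ / 2 * ‖x - y‖ ^ 2 ≤ g x

/-- Descent lemma for a differentiable function with `L`-Lipschitz gradient. -/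
theorem LSmooth.le_quadratic {d : ℕ} {L : ℝ} {g : EuclideanSpace ℝ (Fin d) → ℝ}
    (hg : Differentiable ℝ g) (hL : LSmooth L g) (x y : EuclideanSpace ℝ (Fin d)) :
    g y ≤ g x + ⟪gradient g x, y - x⟫ + L / 2 * ‖y - x‖ ^ 2 := by
  set v := y - x with hv
  let φ : ℝ → ℝ := fun t => g (x + t • v) - t * ⟪gradient g x, v⟫ - L / 2 * ‖v‖ ^ 2 * t ^ 2
  have hder : ∀ t, HasDerivAt φ
      (⟪gradient g (x + t • v), v⟫ - ⟪gradient g x, v⟫ - L / 2 * ‖v‖ ^ 2 * (2 * t)) t := by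
    intro t
    have hline : HasDerivAt (fun s : ℝ => x + s • v) v t := by
      simpa using ((hasDerivAt_id t).smul_const v).const_add x
    have hcomp : HasDerivAt (fun s : ℝ => g (x + s • v)) ⟪gradient g (x + t • v), v⟫ t := by
      exact (hg (x + t • v)).hasGradientAt.hasFDerivAt.comp_hasDerivAt t hline
    have hlin : HasDerivAt (fun s : ℝ => s * ⟪gradient g x, v⟫) ⟪gradient g x, v⟫ t := by
      simpa using (hasDerivAt_id t).mul_const ⟪gradient g x, v⟫
    have hsq : HasDerivAt (fun s : ℝ => L / 2 * ‖v‖ ^ 2 * s ^ 2) (L / 2 * ‖v‖ ^ 2 * (2 * t)) t := by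
      simpa using (hasDerivAt_pow 2 t).const_mul (L / 2 * ‖v‖ ^ 2)
    exact (hcomp.sub hlin).sub hsq
  have hanti : AntitoneOn φ (Set.Ici 0) := by
    refine antitoneOn_of_deriv_nonpos (convex_Ici 0)
      (fun t _ => (hder t).continuousAt.continuousWithinAt)
      (fun t _ => (hder t).differentiableAt.differentiableWithinAt) fun t ht => ?_
    have ht : 0 < t := by simpa using ht
    rw [(hder t).deriv, ← inner_sub_left]
    have hcs := real_inner_le_norm (gradient g (x + t • v) - gradient g x) v
    have hlip := hL (x + t • v) x
    rw [add_sub_cancel_left, norm_smul, Real.norm_of_nonneg ht.le] at hlip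
    nlinarith [mul_le_mul_of_nonneg_right hlip (norm_nonneg v)]
  have h01 := hanti (Set.mem_Ici.2 le_rfl) (Set.mem_Ici.2 zero_le_one) zero_le_one
  have hxv : x + v = y := by simp [hv]
  simp only [φ, one_smul, zero_smul, hxv, add_zero] at h01
  linarith

/-- On a nontrivial space the strong convexity constant is at most the smoothness constant. -/
theorem StrongConvexWith.le_of_lSmooth {d : ℕ} [Nontrivial (EuclideanSpace ℝ (Fin d))]
    {L μ : ℝ} {g : EuclideanSpace ℝ (Fin d) → ℝ} (hg : Differentiable ℝ g)
    (hμ : StrongConvexWith μ g) (hL : LSmooth L g) : μ ≤ L := by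
  obtain ⟨x, y, hxy⟩ := exists_pair_ne (EuclideanSpace ℝ (Fin d))
  have hpos : 0 < ‖x - y‖ ^ 2 := by
    have := norm_pos_iff.2 (sub_ne_zero.2 hxy)
    positivity
  have h := (hμ x y).trans (hL.le_quadratic hg y x)
  exact le_of_mul_le_mul_right (by linarith) hpos

/-- One gradient step of size `1 / L` contracts the gap to the infimum by `1 - μ / L`, given
quadratic upper and lower bounds around the current point. -/
theorem gap_gradient_step_le {E : Type*} [NormedAddCommGroup E] [InnerProductSpace ℝ E]
    {F : E → ℝ} {L μ : ℝ} (hL : 0 < L) (hμ : 0 < μ) {x G : E}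
    (hup : ∀ y, F y ≤ F x + ⟪G, y - x⟫ + L / 2 * ‖y - x‖ ^ 2)
    (hlow : ∀ y, F x + ⟪G, y - x⟫ + μ / 2 * ‖y - x‖ ^ 2 ≤ F y) :
    F (x - (1 / L) • G) - ⨅ y, F y ≤ (1 - μ / L) * (F x - ⨅ y, F y) := by
  have hinf : F x - ‖G‖ ^ 2 / (2 * μ) ≤ ⨅ y, F y := by
    refine le_ciInf fun y => le_trans ?_ (hlow y)
    have hsq : 0 ≤ ‖G + μ • (y - x)‖ ^ 2 := by positivity
    rw [norm_add_sq_real, inner_smul_right, norm_smul, Real.norm_of_nonneg hμ.le] at hsq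
    have hdiv : ‖G‖ ^ 2 / (2 * μ) + ⟪G, y - x⟫ + μ / 2 * ‖y - x‖ ^ 2
        = (‖G‖ ^ 2 + 2 * (μ * ⟪G, y - x⟫) + (μ * ‖y - x‖) ^ 2) / (2 * μ) := by
      field_simp
    have : 0 ≤ (‖G‖ ^ 2 + 2 * (μ * ⟪G, y - x⟫) + (μ * ‖y - x‖) ^ 2) / (2 * μ) := by positivity
    linarith
  have hdesc := hup (x - (1 / L) • G)
  have hsub : x - (1 / L) • G - x = -((1 / L) • G) := by abel
  rw [hsub, inner_neg_right, inner_smul_right, real_inner_self_eq_norm_sq, norm_neg, norm_smul,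
    Real.norm_of_nonneg (by positivity)] at hdesc
  have hstep : F (x - (1 / L) • G) ≤ F x - ‖G‖ ^ 2 / (2 * L) := by
    refine hdesc.trans (le_of_eq ?_)
    field_simp
    ring
  have hPL : μ / L * (F x - ⨅ y, F y) ≤ ‖G‖ ^ 2 / (2 * L) := by
    calc μ / L * (F x - ⨅ y, F y) ≤ μ / L * (‖G‖ ^ 2 / (2 * μ)) := by
          gcongr
          linarith
      _ = ‖G‖ ^ 2 / (2 * L) := by field_simp
  linarith

/-- Quadratic upper bound for the pullback of `g` along `x ↦ a • x + (1 - a) • c`. -/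
theorem LSmooth.le_quadratic_comp_affine {d : ℕ} {L : ℝ} {g : EuclideanSpace ℝ (Fin d) → ℝ}
    (hg : Differentiable ℝ g) (hL : LSmooth L g) (a : ℝ) (c x y : EuclideanSpace ℝ (Fin d)) :
    g (a • y + (1 - a) • c) ≤ g (a • x + (1 - a) • c)
      + ⟪a • gradient g (a • x + (1 - a) • c), y - x⟫ + a ^ 2 * L / 2 * ‖y - x‖ ^ 2 := by
  have h := hL.le_quadratic hg (a • x + (1 - a) • c) (a • y + (1 - a) • c)
  rw [add_sub_add_right_eq_sub, ← smul_sub, norm_smul, mul_pow, Real.norm_eq_abs, sq_abs,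
    real_inner_smul_right, ← real_inner_smul_left] at h
  linarith

/-- Quadratic lower bound for the pullback of `g` along `x ↦ a • x + (1 - a) • c`. -/
theorem StrongConvexWith.quadratic_le_comp_affine {d : ℕ} {μ : ℝ}
    {g : EuclideanSpace ℝ (Fin d) → ℝ} (hμ : StrongConvexWith μ g) (a : ℝ)
    (c x y : EuclideanSpace ℝ (Fin d)) :
    g (a • x + (1 - a) • c) + ⟪a • gradient g (a • x + (1 - a) • c), y - x⟫
      + a ^ 2 * μ / 2 * ‖y - x‖ ^ 2 ≤ g (a • y + (1 - a) • c) := by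
  have h := hμ (a • y + (1 - a) • c) (a • x + (1 - a) • c)
  rw [add_sub_add_right_eq_sub, ← smul_sub, norm_smul, mul_pow, Real.norm_eq_abs, sq_abs,
    real_inner_smul_right, ← real_inner_smul_left] at h
  linarith

theorem gradient_eq_zero_of_forall_le {E : Type*} [NormedAddCommGroup E] [InnerProductSpace ℝ E]
    [CompleteSpace E] {g : E → ℝ} {c : E} (hc : ∀ y, g c ≤ g y) : gradient g c = 0 := by
  have hmin : IsLocalMin g c := Filter.Eventually.of_forall hc
  simp [gradient, hmin.fderiv_eq_zero]

theorem norm_sub_sq_le_iSup_ne {E ι : Type*} [NormedAddCommGroup E] [Finite ι] (v : ι → E)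
    (i j : ι) : ‖v i - v j‖ ^ 2 ≤ ⨆ i, ⨆ j, ⨆ (_ : i ≠ j), ‖v i - v j‖ ^ 2 := by
  have hne : ‖v i - v j‖ ^ 2 ≤ ⨆ (_ : i ≠ j), ‖v i - v j‖ ^ 2 := by
    by_cases h : i = j
    · simp [h]
    · simp [h]
  exact hne.trans <| (le_ciSup (f := fun j => ⨆ (_ : i ≠ j), ‖v i - v j‖ ^ 2)
    (Set.finite_range _).bddAbove j).trans <|
    le_ciSup (f := fun i => ⨆ j, ⨆ (_ : i ≠ j), ‖v i - v j‖ ^ 2) (Set.finite_range _).bddAbove i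

/-- A convex combination of points is within the diameter bound `D` of each of them. -/
theorem norm_sum_smul_sub_sq_le {E ι : Type*} [NormedAddCommGroup E] [NormedSpace ℝ E] [Fintype ι]
    {v : ι → E} {w : ι → ℝ} {D : ℝ} (hw : ∀ i, 0 ≤ w i) (hw1 : ∑ i, w i = 1)
    (hD : ∀ i j, ‖v i - v j‖ ^ 2 ≤ D) (i : ι) : ‖∑ j, w j • v j - v i‖ ^ 2 ≤ D := by
  have hD0 : 0 ≤ D := (sq_nonneg _).trans (hD i i)
  have hmem : ∑ j, w j • v j ∈ Metric.closedBall (v i) √D := by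
    refine (convex_closedBall (v i) √D).sum_mem (fun j _ => hw j) hw1 fun j _ => ?_
    rw [mem_closedBall_iff_norm]
    exact Real.le_sqrt_of_sq_le (hD j i)
  rw [mem_closedBall_iff_norm] at hmem
  exact (Real.le_sqrt (norm_nonneg _) hD0).1 hmem

/-- linear convergence of distributed gradient descent for FLIX with
arbitrary personalization parameters, initialized at the weighted average `x^avg`. -/
theorem dgd_convergence_arbitrary_alpha {d n : ℕ} (hn : 0 < n)
    (f : Fin n → EuclideanSpace ℝ (Fin d) → ℝ)
    (hdiff : ∀ i, Differentiable ℝ (f i))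
    (L μ : Fin n → ℝ) (hμpos : ∀ i, 0 < μ i)
    (hsmooth : ∀ i, LSmooth (L i) (f i))
    (hsc : ∀ i, StrongConvexWith (μ i) (f i))
    (α : Fin n → ℝ) (hα : ∀ i, α i ∈ Set.Ioc (0 : ℝ) 1)
    (xs : Fin n → EuclideanSpace ℝ (Fin d))
    (hxs : ∀ i y, f i (xs i) ≤ f i y)
    (ftilde : EuclideanSpace ℝ (Fin d) → ℝ)
    (hft : ftilde = fun x => (1 / n : ℝ) * ∑ i, f i (α i • x + (1 - α i) • xs i))
    (Lα : ℝ) (hLα : Lα = (1 / n : ℝ) * ∑ i, α i ^ 2 * L i)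
    (μα : ℝ) (hμα : μα = (1 / n : ℝ) * ∑ i, α i ^ 2 * μ i)
    (Lhat : ℝ) (hLhat : Lhat = (1 / n : ℝ) * ∑ i, L i)
    (w : Fin n → ℝ) (hw : ∀ i, w i = α i ^ 2 * L i / (n * Lα))
    (xavg : EuclideanSpace ℝ (Fin d)) (hxavg : xavg = ∑ i, w i • xs i)
    (D : ℝ) (hD : D = ⨆ i, ⨆ j, ⨆ (_ : i ≠ j), ‖xs i - xs j‖ ^ 2)
    (αmax : ℝ) (hαmax : αmax = ⨆ i, α i)
    (x : ℕ → EuclideanSpace ℝ (Fin d)) (hx0 : x 0 = xavg)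
    (hstep : ∀ k, x (k + 1) = x k
      - ((1 / Lα) * (1 / n : ℝ)) •
          ∑ i, α i • gradient (f i) (α i • x k + (1 - α i) • xs i))
    (K : ℕ) :
    ftilde (x K) - ⨅ y, ftilde y ≤ (1 - μα / Lα) ^ K * (αmax ^ 2 * Lhat * D / 2) := by
  have : Nonempty (Fin n) := ⟨⟨0, hn⟩⟩
  have hn0 : (0 : ℝ) < n := by exact_mod_cast hn
  have hDle : ∀ i j, ‖xs i - xs j‖ ^ 2 ≤ D := fun i j => hD ▸ norm_sub_sq_le_iSup_ne xs i j
  rcases subsingleton_or_nontrivial (EuclideanSpace ℝ (Fin d)) with hsub | hnt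
  · have hD0 : D = 0 := by
      simp [hD, Subsingleton.elim (xs _) (xs (Classical.arbitrary _))]
    have hinf : ⨅ y, ftilde y = ftilde (x K) := by
      rw [show ftilde = fun _ => ftilde (x K) from
        funext fun y => congrArg ftilde (Subsingleton.elim _ _), ciInf_const]
    simp [hD0, hinf]
  have hμL : ∀ i, μ i ≤ L i := fun i => (hsc i).le_of_lSmooth (hdiff i) (hsmooth i)
  have hLpos : ∀ i, 0 < L i := fun i => (hμpos i).trans_le (hμL i)
  have hαpos : ∀ i, 0 < α i := fun i => (hα i).1
  have hμα0 : 0 < μα := by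
    rw [hμα]
    exact mul_pos (by positivity) <| Finset.sum_pos
      (fun i _ => mul_pos (pow_pos (hαpos i) 2) (hμpos i)) Finset.univ_nonempty
  have hμLα : μα ≤ Lα := by
    rw [hμα, hLα]
    gcongr with i
    exact hμL i
  have hLα0 : 0 < Lα := hμα0.trans_le hμLα
  let G : EuclideanSpace ℝ (Fin d) → EuclideanSpace ℝ (Fin d) := fun z =>
    (1 / n : ℝ) • ∑ i, α i • gradient (f i) (α i • z + (1 - α i) • xs i)
  have hup : ∀ z y, ftilde y ≤ ftilde z + ⟪G z, y - z⟫ + Lα / 2 * ‖y - z‖ ^ 2 := by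
    intro z y
    have h := mul_le_mul_of_nonneg_left (Finset.sum_le_sum fun i (_ : i ∈ Finset.univ) =>
      (hsmooth i).le_quadratic_comp_affine (hdiff i) (α i) (xs i) z y)
      (by positivity : (0 : ℝ) ≤ 1 / n)
    simp only [Finset.sum_add_distrib, ← Finset.sum_mul, ← Finset.sum_div, ← sum_inner] at h
    simp only [hft, hLα, G, real_inner_smul_left]
    linarith
  have hlow : ∀ z y, ftilde z + ⟪G z, y - z⟫ + μα / 2 * ‖y - z‖ ^ 2 ≤ ftilde y := by
    intro z y
    have h := mul_le_mul_of_nonneg_left (Finset.sum_le_sum fun i (_ : i ∈ Finset.univ) =>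
      (hsc i).quadratic_le_comp_affine (α i) (xs i) z y)
      (by positivity : (0 : ℝ) ≤ 1 / n)
    simp only [Finset.sum_add_distrib, ← Finset.sum_mul, ← Finset.sum_div, ← sum_inner] at h
    simp only [hft, hμα, G, real_inner_smul_left]
    linarith
  have hinf : (1 / n : ℝ) * ∑ i, f i (xs i) ≤ ⨅ y, ftilde y := by
    refine le_ciInf fun y => ?_
    simp only [hft]
    gcongr with i
    exact hxs i _
  have hw0 : ∀ i, 0 ≤ w i := fun i => by
    have := hLpos i
    rw [hw]
    positivity
  have hw1 : ∑ i, w i = 1 := by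
    have hsum : ∑ i, α i ^ 2 * L i = n * Lα := by
      rw [hLα]
      field_simp
    simp only [hw, ← Finset.sum_div, hsum]
    exact div_self (by positivity)
  have hD0 : 0 ≤ D := (sq_nonneg _).trans (hDle ⟨0, hn⟩ ⟨0, hn⟩)
  have hLα_le : Lα ≤ αmax ^ 2 * Lhat := by
    rw [hLα, hLhat, mul_left_comm, Finset.mul_sum Finset.univ L]
    gcongr with i
    · exact (hLpos i).le
    · exact (hαpos i).le
    · exact hαmax ▸ le_ciSup (Set.finite_range α).bddAbove i
  have hinit : ftilde xavg - ⨅ y, ftilde y ≤ αmax ^ 2 * Lhat * D / 2 := by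
    have hcomp : ∀ i, f i (α i • xavg + (1 - α i) • xs i)
        ≤ f i (xs i) + α i ^ 2 * L i / 2 * D := by
      intro i
      have h := (hsmooth i).le_quadratic_comp_affine (hdiff i) (α i) (xs i) (xs i) xavg
      rw [← add_smul, add_sub_cancel, one_smul, gradient_eq_zero_of_forall_le (hxs i), smul_zero,
        inner_zero_left, add_zero] at h
      have hdist : ‖xavg - xs i‖ ^ 2 ≤ D := hxavg ▸ norm_sum_smul_sub_sq_le hw0 hw1 hDle i
      have := hLpos i
      exact h.trans (by gcongr)
    have h := mul_le_mul_of_nonneg_left (Finset.sum_le_sum fun i (_ : i ∈ Finset.univ) => hcomp i)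
      (by positivity : (0 : ℝ) ≤ 1 / n)
    simp only [Finset.sum_add_distrib, ← Finset.sum_mul, ← Finset.sum_div] at h
    have hxa : ftilde xavg ≤ (1 / n : ℝ) * ∑ i, f i (xs i) + Lα * D / 2 := by
      simp only [hft, hLα]
      linarith
    have := mul_le_mul_of_nonneg_right hLα_le hD0
    linarith
  induction K with
  | zero => simpa [hx0] using hinit
  | succ k ih =>
    have hxk : x (k + 1) = x k - (1 / Lα) • G (x k) := by rw [hstep, mul_smul]
    have hrate : 0 ≤ 1 - μα / Lα := sub_nonneg.2 ((div_le_one hLα0).2 hμLα)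
    rw [hxk, pow_succ', mul_assoc]
    exact (gap_gradient_step_le hLα0 hμα0 (hup (x k)) (hlow (x k))).trans
      (mul_le_mul_of_nonneg_left ih hrate)
end

section
/- Let f₁,…,fₙ : ℝ^d → ℝ be differentiable with each f_i L_i-smooth and μ_i-strongly convex (μ_i > 0), let α > 0, let x_i be the minimizer of f_i, define f̃(x) = (1/n)∑_{i=1}^n f_i(α x + (1−α)x_i), let x* be a global minimizer of f̃, and let μ̄ = (1/n)∑_{i=1}^n μ_i. Then for every x⁰ ∈ ℝ^d: ‖x⁰ − x*‖² ≤ (1/μ̄)·(1/n)∑_{i=1}^n L_i ‖x⁰ − x_i‖². -/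
open scoped RealInnerProductSpace

theorem hasDerivAt_comp_line {d : ℕ} {g : EuclideanSpace ℝ (Fin d) → ℝ}
    (hg : Differentiable ℝ g) (z v : EuclideanSpace ℝ (Fin d)) (t : ℝ) :
    HasDerivAt (fun s : ℝ => g (z + s • v)) ⟪gradient g (z + t • v), v⟫ t := by
  have hline : HasDerivAt (fun s : ℝ => z + s • v) v t := by
    simpa using ((hasDerivAt_id t).smul_const v).const_add z
  simpa [Function.comp_def] using
    (hg (z + t • v)).hasGradientAt.hasFDerivAt.comp_hasDerivAt t hline

theorem gradient_eq_zero_of_forall_le_s8 {d : ℕ} {g : EuclideanSpace ℝ (Fin d) → ℝ}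
    {z : EuclideanSpace ℝ (Fin d)} (hz : ∀ y, g z ≤ g y) : gradient g z = 0 := by
  have hmin : IsLocalMin g z := Filter.Eventually.of_forall hz
  simp [gradient, hmin.fderiv_eq_zero]

/-- Quadratic upper bound of a smooth function around a minimizer. -/
theorem LSmooth.le_add_of_forall_le {d : ℕ} {L : ℝ} {g : EuclideanSpace ℝ (Fin d) → ℝ}
    (hL : LSmooth L g) (hg : Differentiable ℝ g) {z : EuclideanSpace ℝ (Fin d)}
    (hz : ∀ y, g z ≤ g y) (v : EuclideanSpace ℝ (Fin d)) :
    g (z + v) ≤ g z + L / 2 * ‖v‖ ^ 2 := by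
  have hderiv (t : ℝ) : HasDerivAt (fun s : ℝ => g (z + s • v) - L / 2 * ‖v‖ ^ 2 * s ^ 2)
      (⟪gradient g (z + t • v), v⟫ - L / 2 * ‖v‖ ^ 2 * (2 * t)) t := by
    simpa using (hasDerivAt_comp_line hg z v t).fun_sub
      ((hasDerivAt_pow 2 t).const_mul (L / 2 * ‖v‖ ^ 2))
  have hanti : AntitoneOn (fun s : ℝ => g (z + s • v) - L / 2 * ‖v‖ ^ 2 * s ^ 2)
      (Set.Icc 0 1) := by
    refine antitoneOn_of_deriv_nonpos (convex_Icc 0 1)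
      (fun t _ => (hderiv t).continuousAt.continuousWithinAt)
      (fun t _ => (hderiv t).differentiableAt.differentiableWithinAt) fun t ht => ?_
    rw [interior_Icc] at ht
    rw [(hderiv t).deriv]
    have hgrad := hL (z + t • v) z
    rw [gradient_eq_zero_of_forall_le_s8 hz, sub_zero, add_sub_cancel_left, norm_smul,
      Real.norm_of_nonneg ht.1.le] at hgrad
    have hinner := real_inner_le_norm (gradient g (z + t • v)) v
    have hmul := mul_le_mul_of_nonneg_right hgrad (norm_nonneg v)
    linarith
  have h := hanti (Set.left_mem_Icc.2 zero_le_one) (Set.right_mem_Icc.2 zero_le_one) zero_le_one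
  simp at h
  linarith

/-- the squared distance from any point to the FLIX minimizer is
bounded by an average of `L_i`-weighted squared distances to the local minimizers. -/
theorem distance_to_optimum_bound {d n : ℕ} (hn : 0 < n)
    (f : Fin n → EuclideanSpace ℝ (Fin d) → ℝ)
    (hdiff : ∀ i, Differentiable ℝ (f i))
    (L μ : Fin n → ℝ) (hμpos : ∀ i, 0 < μ i)
    (hsmooth : ∀ i, LSmooth (L i) (f i))
    (hsc : ∀ i, StrongConvexWith (μ i) (f i))
    (α : ℝ) (hα : 0 < α)
    (xs : Fin n → EuclideanSpace ℝ (Fin d))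
    (hxs : ∀ i y, f i (xs i) ≤ f i y)
    (ftilde : EuclideanSpace ℝ (Fin d) → ℝ)
    (hft : ftilde = fun x => (1 / n : ℝ) * ∑ i, f i (α • x + (1 - α) • xs i))
    (xstar : EuclideanSpace ℝ (Fin d)) (hxstar : ∀ y, ftilde xstar ≤ ftilde y)
    (μbar : ℝ) (hμbar : μbar = (1 / n : ℝ) * ∑ i, μ i)
    (x0 : EuclideanSpace ℝ (Fin d)) :
    ‖x0 - xstar‖ ^ 2 ≤ (1 / μbar) * ((1 / n : ℝ) * ∑ i, L i * ‖x0 - xs i‖ ^ 2) := by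
  have hn' : (0 : ℝ) < n := Nat.cast_pos.2 hn
  have : Nonempty (Fin n) := ⟨⟨0, hn⟩⟩
  have hμsum : 0 < ∑ i, μ i := Finset.sum_pos (fun i _ => hμpos i) Finset.univ_nonempty
  have hmin (y) : ∑ i, f i (α • xstar + (1 - α) • xs i) ≤ ∑ i, f i (α • y + (1 - α) • xs i) := by
    have h := hxstar y
    rw [hft] at h
    exact le_of_mul_le_mul_left h (by positivity)
  have hstationary :
      ∑ i, ⟪gradient (f i) (α • xstar + (1 - α) • xs i), α • (x0 - xstar)⟫ = 0 := by
    have hderiv := HasDerivAt.fun_sum (u := Finset.univ) fun i _ =>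
      hasDerivAt_comp_line (hdiff i) (α • xstar + (1 - α) • xs i) (α • (x0 - xstar)) 0
    simp only [zero_smul, add_zero] at hderiv
    refine IsLocalMin.hasDerivAt_eq_zero (Filter.Eventually.of_forall fun t => ?_) hderiv
    simp only [zero_smul, add_zero]
    refine (hmin (xstar + t • (x0 - xstar))).trans_eq (Finset.sum_congr rfl fun i _ => ?_)
    congr 1
    module
  have hterm (i) : ⟪gradient (f i) (α • xstar + (1 - α) • xs i), α • (x0 - xstar)⟫
      + α ^ 2 / 2 * (μ i * ‖x0 - xstar‖ ^ 2) ≤ α ^ 2 / 2 * (L i * ‖x0 - xs i‖ ^ 2) := by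
    have hlower := hsc i (α • x0 + (1 - α) • xs i) (α • xstar + (1 - α) • xs i)
    have hupper := (hsmooth i).le_add_of_forall_le (hdiff i) (hxs i) (α • (x0 - xs i))
    have hlocal := hxs i (α • xstar + (1 - α) • xs i)
    rw [show α • x0 + (1 - α) • xs i - (α • xstar + (1 - α) • xs i) = α • (x0 - xstar) by
      module, norm_smul, Real.norm_of_nonneg hα.le, mul_pow] at hlower
    rw [show xs i + α • (x0 - xs i) = α • x0 + (1 - α) • xs i by module, norm_smul,
      Real.norm_of_nonneg hα.le, mul_pow] at hupper
    linarith
  have hsum := Finset.sum_le_sum fun i (_ : i ∈ Finset.univ) => hterm i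
  rw [Finset.sum_add_distrib, hstationary, zero_add, ← Finset.mul_sum, ← Finset.mul_sum,
    ← Finset.sum_mul] at hsum
  have hbound := le_of_mul_le_mul_left hsum (by positivity)
  rw [hμbar, one_div_mul_eq_div, one_div_mul_eq_div, one_div_mul_eq_div,
    div_div_div_cancel_right₀ hn'.ne', le_div_iff₀ hμsum]
  linarith
end
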